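/- Let M be a finitely generated module over A = ℤ[t₁^{±1},...,t_n^{±1}]. Suppose for every 1 ≤ i ≤ n there exists a nonzero integer d_i, a sequence of integers r_{i,j} → ∞, and A-module automorphisms w_{i,j} : M → M such that w_{i,j}^{r_{i,j}} equals multiplication by t_i^{d_i}. Then M is finitely generated as a ℤ-module. -/

import Mathlib

open Filter Polynomial TensorProduct

/-- A constant which is an `r`-th power in a purely transcendental extension is an `r`-th power
in the base field. -/
theorem exists_pow_eq_of_pow_eq_algebraMap_fractionRing {ι E : Type*} [Field E] {c : E} {r : ℕ}
    (hr : 0 < r) (z : FractionRing (MvPolynomial ι E))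
    (hz : z ^ r = algebraMap E (FractionRing (MvPolynomial ι E)) c) : ∃ y : E, y ^ r = c := by
  rw [IsScalarTower.algebraMap_apply E (MvPolynomial ι E)] at hz
  obtain ⟨p, rfl⟩ := IsIntegrallyClosedIn.exists_algebraMap_eq_of_isIntegral_pow
    (R := MvPolynomial ι E) hr (hz ▸ isIntegral_algebraMap)
  rw [← map_pow] at hz
  have hp := IsFractionRing.injective (MvPolynomial ι E) _ hz
  exact ⟨MvPolynomial.constantCoeff p, by
    rw [← map_pow, hp, MvPolynomial.algebraMap_eq, MvPolynomial.constantCoeff_C]⟩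

/-- For a finitely generated field extension `K / E`, some fixed positive power of each element
of `E` that is an `r`-th power in `K` is an `r`-th power in `E`. -/
theorem exists_pos_forall_pow_eq_algebraMap (E K : Type*) [Field E] [Field K] [Algebra E K]
    [Algebra.EssFiniteType E K] : ∃ D : ℕ, 0 < D ∧ ∀ (c : E) (r : ℕ) (y : K), 0 < r →
      y ^ r = algebraMap E K c → ∃ z : E, z ^ r = c ^ D := by
  obtain ⟨s, hs⟩ := exists_isTranscendenceBasis E K
  have : Algebra.IsAlgebraic (IntermediateField.adjoin E (Set.range ((↑) : s → K))) K :=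
    hs.isAlgebraic_field
  let F := IntermediateField.adjoin E (Set.range ((↑) : s → K))
  have : Algebra.EssFiniteType F K := .of_comp E F K
  have : Module.Finite F K := Algebra.finite_of_essFiniteType_of_isAlgebraic
  refine ⟨Module.finrank F K, Module.finrank_pos, fun c r y hr hy ↦ ?_⟩
  have hN : Algebra.norm F y ^ r = algebraMap E F (c ^ Module.finrank F K) := by
    rw [← map_pow, hy, IsScalarTower.algebraMap_apply E F K, Algebra.norm_algebraMap, map_pow]
  refine exists_pow_eq_of_pow_eq_algebraMap_fractionRing hr
    (hs.1.aevalEquivField.symm (Algebra.norm F y)) ?_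
  rw [← map_pow, hN, AlgEquiv.commutes]

theorem mem_range_algebraMap_of_forall_exists_pow_eq (R : Type*) {E : Type*} [CommRing R]
    [IsDedekindDomain R] [Field E] [Algebra R E] [IsFractionRing R E] {c : E}
    (hc : ∀ N : ℕ, ∃ r ≥ N, ∃ y : E, y ^ r = c) : c ∈ (algebraMap R E).range := by
  refine IsDedekindDomain.HeightOneSpectrum.mem_integers_of_valuation_le_one E c fun v ↦ ?_
  by_contra! hv
  obtain ⟨k, hk⟩ := WithZero.ne_zero_iff_exists.1 (zero_lt_one.trans hv).ne'
  obtain ⟨r, hr, y, rfl⟩ := hc (k.toAdd.natAbs + 1)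
  have hy : v.valuation E y ≠ 0 := by
    intro h
    rw [map_pow, h, zero_pow (by omega)] at hv
    exact not_lt_zero hv
  obtain ⟨l, hl⟩ := WithZero.ne_zero_iff_exists.1 hy
  rw [← hk, WithZero.one_lt_coe] at hv
  rw [map_pow, ← hl, ← WithZero.coe_pow, WithZero.coe_inj] at hk
  have h0 : 0 < k.toAdd := hv
  have h1 : k.toAdd = r * l.toAdd := by rw [hk, toAdd_pow, nsmul_eq_mul]
  have h2 : (r : ℤ) ≤ k.toAdd := Int.le_of_dvd h0 ⟨_, h1⟩
  omega

/-- An element of `E` with roots of arbitrarily large order in a finitely generated extension of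
`E` is integral over each Dedekind domain with fraction field `E`. -/
theorem isIntegral_of_forall_exists_pow_eq_algebraMap (R : Type*) {E K : Type*} [CommRing R]
    [IsDedekindDomain R] [Field E] [Algebra R E] [IsFractionRing R E] [Field K] [Algebra E K]
    [Algebra.EssFiniteType E K] {c : E}
    (hc : ∀ N : ℕ, ∃ r ≥ N, ∃ y : K, y ^ r = algebraMap E K c) : IsIntegral R c := by
  obtain ⟨D, hD, h⟩ := exists_pos_forall_pow_eq_algebraMap E K
  refine IsIntegral.of_pow hD ?_
  obtain ⟨x, hx⟩ := mem_range_algebraMap_of_forall_exists_pow_eq R (c := c ^ D) fun N ↦ by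
    obtain ⟨r, hr, y, hy⟩ := hc (N + 1)
    exact ⟨r, by omega, h c r y (by omega) hy⟩
  exact hx ▸ isIntegral_algebraMap

theorem isAlgebraic_of_forall_exists_pow_eq (k : Type*) {K : Type*} [Field k] [Field K]
    [Algebra k K] [Algebra.EssFiniteType k K] {a : K}
    (ha : ∀ N : ℕ, ∃ r ≥ N, ∃ y : K, y ^ r = a) : IsAlgebraic k a := by
  by_contra htr
  have htr' : Transcendental k a⁻¹ := fun h ↦ htr (IsAlgebraic.inv_iff.1 h)
  have hinj : Function.Injective (aeval (R := k) a⁻¹) :=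
    transcendental_iff_injective.1 htr'
  let φ : FractionRing k[X] →ₐ[k] K := IsFractionRing.liftAlgHom hinj
  have hφ : φ (algebraMap k[X] (FractionRing k[X]) X) = a⁻¹ := by
    simp [φ]
  let _ : Algebra (FractionRing k[X]) K := φ.toRingHom.toAlgebra
  have : IsScalarTower k (FractionRing k[X]) K := .of_algebraMap_eq fun x ↦ (φ.commutes x).symm
  have : Algebra.EssFiniteType (FractionRing k[X]) K := .of_comp k _ K
  have hX : IsIntegral k[X] (algebraMap k[X] (FractionRing k[X]) X)⁻¹ := by
    refine isIntegral_of_forall_exists_pow_eq_algebraMap (K := K) k[X] fun N ↦ ?_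
    obtain ⟨r, hr, y, hy⟩ := ha N
    refine ⟨r, hr, y, ?_⟩
    change _ = φ _
    rw [hy, map_inv₀, hφ, inv_inv]
  obtain ⟨p, hp⟩ := IsIntegrallyClosed.isIntegral_iff.1 hX
  have hX0 : algebraMap k[X] (FractionRing k[X]) X ≠ 0 := by simp
  refine not_isUnit_X (R := k) (IsUnit.of_mul_eq_one p ?_)
  apply IsFractionRing.injective k[X] (FractionRing k[X])
  rw [map_mul, hp, mul_inv_cancel₀ hX0, map_one]

/-- In a finitely generated field, an element with roots of arbitrarily large order is integral
over `ℤ`. -/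
theorem isIntegral_int_of_forall_exists_pow_eq {K : Type*} [Field K] [alg : Algebra ℤ K]
    [Algebra.EssFiniteType ℤ K] {a : K}
    (ha : ∀ N : ℕ, ∃ r ≥ N, ∃ y : K, y ^ r = a) : IsIntegral ℤ a := by
  obtain rfl : alg = Ring.toIntAlgebra K := Subsingleton.elim _ _
  obtain ⟨p, hp⟩ := CharP.exists K
  obtain hp' | rfl := CharP.char_is_prime_or_zero K p
  · have : Fact p.Prime := ⟨hp'⟩
    let _ : Algebra (ZMod p) K := ZMod.algebra K p
    have : Algebra.EssFiniteType (ZMod p) K := .of_comp ℤ _ K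
    have : Algebra.IsIntegral ℤ (ZMod p) := Algebra.IsIntegral.of_surjective
      (Algebra.ofId ℤ (ZMod p)) ZMod.intCast_surjective
    exact isIntegral_trans a (isAlgebraic_of_forall_exists_pow_eq (ZMod p) ha).isIntegral
  · have : CharZero K := CharP.charP_to_charZero K
    have : Algebra.EssFiniteType ℚ K := .of_comp ℤ _ K
    have halg := (isAlgebraic_of_forall_exists_pow_eq ℚ ha).isIntegral
    have : FiniteDimensional ℚ (IntermediateField.adjoin ℚ {a}) :=
      IntermediateField.adjoin.finiteDimensional halg
    have : NumberField (IntermediateField.adjoin ℚ {a}) := { }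
    have : Algebra.EssFiniteType (IntermediateField.adjoin ℚ {a}) K := .of_comp ℤ _ K
    have h := isIntegral_of_forall_exists_pow_eq_algebraMap (K := K)
      (NumberField.RingOfIntegers (IntermediateField.adjoin ℚ {a}))
      (c := IntermediateField.AdjoinSimple.gen ℚ a) (by simpa using ha)
    have h' : IsIntegral ℤ (IntermediateField.AdjoinSimple.gen ℚ a) := isIntegral_trans _ h
    simpa using h'.map (IsScalarTower.toAlgHom ℤ (IntermediateField.adjoin ℚ {a}) K)

theorem Ideal.essFiniteType_residueField {R A : Type*} [CommRing R] [CommRing A] [Algebra R A]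
    [Algebra.EssFiniteType R A] (p : Ideal A) [p.IsPrime] :
    Algebra.EssFiniteType R p.ResidueField := by
  have : Algebra.EssFiniteType (A ⧸ p) p.ResidueField := .of_isLocalization _ (nonZeroDivisors _)
  have : Algebra.EssFiniteType A p.ResidueField := .comp A (A ⧸ p) _
  exact .comp R A _

/-- Over a finitely generated ring, a scalar with roots of arbitrarily large order in `End M` is
integral over `ℤ` in the residue field at each point of the support of `M`. -/
theorem isIntegral_algebraMap_residueField {A M : Type*} [CommRing A] [Algebra ℤ A]
    [Algebra.EssFiniteType ℤ A] [AddCommGroup M] [Module A M] [Module.Finite A M] {s : A}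
    (hs : ∀ N : ℕ, ∃ r ≥ N, ∃ f : Module.End A M, f ^ r = algebraMap A (Module.End A M) s)
    (p : Ideal A) [hp : p.IsPrime] (hM : Module.annihilator A M ≤ p) :
    IsIntegral ℤ (algebraMap A p.ResidueField s) := by
  have : Algebra.EssFiniteType ℤ p.ResidueField := p.essFiniteType_residueField
  have : Nontrivial (p.ResidueField ⊗[A] M) :=
    (Module.mem_support_iff_nontrivial_residueField_tensorProduct ⟨p, hp⟩).1
      (Module.mem_support_iff_of_finite.2 hM)
  refine IsIntegral.of_pow (n := Module.finrank p.ResidueField (p.ResidueField ⊗[A] M))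
    Module.finrank_pos (isIntegral_int_of_forall_exists_pow_eq fun N ↦ ?_)
  obtain ⟨r, hr, f, hf⟩ := hs N
  refine ⟨r, hr, LinearMap.det (f.baseChange p.ResidueField), ?_⟩
  have h : f.baseChange p.ResidueField ^ r =
      algebraMap A p.ResidueField s • (LinearMap.id : Module.End p.ResidueField _) := by
    rw [← LinearMap.baseChange_pow, hf]
    ext m
    simp [TensorProduct.tmul_smul, TensorProduct.smul_tmul', Algebra.smul_def]
  rw [← map_pow, h, LinearMap.det_smul, LinearMap.det_id, mul_one]

theorem isIntegral_mk_of_forall_isPrime {R A : Type*} [CommRing R] [CommRing A] [Algebra R A]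
    {I : Ideal A} {s : A}
    (h : ∀ p : Ideal A, p.IsPrime → I ≤ p → IsIntegral R (Ideal.Quotient.mk p s)) :
    IsIntegral R (Ideal.Quotient.mk I s) := by
  let S : Submonoid A :=
    { carrier := aeval (R := R) s '' {f | f.Monic}
      one_mem' := ⟨1, monic_one, map_one _⟩
      mul_mem' := by
        rintro _ _ ⟨f, hf, rfl⟩ ⟨g, hg, rfl⟩
        exact ⟨f * g, hf.mul hg, map_mul _ f g⟩ }
  by_cases hd : Disjoint (I : Set A) S
  · obtain ⟨p, hp, hIp, hpS⟩ := I.exists_le_prime_disjoint S hd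
    obtain ⟨f, hf, hfs⟩ := h p hp hIp
    refine (Set.disjoint_left.1 hpS ?_ ⟨f, hf, rfl⟩).elim
    rw [SetLike.mem_coe, ← Ideal.Quotient.eq_zero_iff_mem]
    exact ((aeval_algHom_apply (Ideal.Quotient.mkₐ R p) s f).symm).trans hfs
  · obtain ⟨_, hI, f, hf, rfl⟩ := Set.not_disjoint_iff.1 hd
    refine ⟨f, hf, ?_⟩
    exact (aeval_algHom_apply (Ideal.Quotient.mkₐ R I) s f).trans
      (Ideal.Quotient.eq_zero_iff_mem.2 hI)

theorem isIntegral_mk_annihilator {A M : Type*} [CommRing A] [Algebra ℤ A]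
    [Algebra.EssFiniteType ℤ A] [AddCommGroup M] [Module A M] [Module.Finite A M] {s : A}
    (hs : ∀ N : ℕ, ∃ r ≥ N, ∃ f : Module.End A M, f ^ r = algebraMap A (Module.End A M) s) :
    IsIntegral ℤ (Ideal.Quotient.mk (Module.annihilator A M) s) := by
  refine isIntegral_mk_of_forall_isPrime fun p hp hM ↦ ?_
  rw [← isIntegral_algHom_iff (IsScalarTower.toAlgHom ℤ (A ⧸ p) p.ResidueField)
    (IsFractionRing.injective (A ⧸ p) p.ResidueField)]
  exact isIntegral_algebraMap_residueField hs p hM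

theorem Module.Finite.of_finite_quotient_annihilator (R : Type*) {A M : Type*} [CommRing R]
    [CommRing A] [Algebra R A] [AddCommGroup M] [Module R M] [Module A M] [IsScalarTower R A M]
    [Module.Finite A M] [Module.Finite R (A ⧸ Module.annihilator A M)] : Module.Finite R M := by
  let _ : Module (A ⧸ Module.annihilator A M) M := Module.quotientAnnihilator
  have : IsScalarTower R (A ⧸ Module.annihilator A M) M := ⟨fun r x m ↦ by
    obtain ⟨x, rfl⟩ := Ideal.Quotient.mk_surjective x
    exact smul_assoc r x m⟩
  have : IsScalarTower A (A ⧸ Module.annihilator A M) M := ⟨fun r x m ↦ by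
    obtain ⟨x, rfl⟩ := Ideal.Quotient.mk_surjective x
    exact smul_assoc r x m⟩
  have : Module.Finite (A ⧸ Module.annihilator A M) M := .of_restrictScalars_finite A _ M
  exact .trans (A ⧸ Module.annihilator A M) M

theorem Units.isIntegral_zpow {R B : Type*} [CommRing R] [CommRing B] [Algebra R B] {x : Bˣ}
    {d : ℤ} (hd : d ≠ 0) (h : IsIntegral R (↑(x ^ d) : B)) (h' : IsIntegral R (↑(x ^ (-d)) : B))
    (k : ℤ) : IsIntegral R (↑(x ^ k) : B) := by
  obtain ⟨h₁, h₂⟩ : IsIntegral R (↑(x ^ d.natAbs) : B) ∧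
      IsIntegral R (↑(x⁻¹ ^ d.natAbs) : B) := by
    simp only [← zpow_natCast, inv_zpow']
    obtain hd | hd := Int.natAbs_eq d
    · rw [← hd]
      exact ⟨h, h'⟩
    · rw [show (d.natAbs : ℤ) = -d by omega, neg_neg]
      exact ⟨h', h⟩
  rw [Units.val_pow_eq_pow_val] at h₁ h₂
  have hx := h₁.of_pow (Int.natAbs_pos.2 hd)
  have hx' := h₂.of_pow (Int.natAbs_pos.2 hd)
  obtain ⟨m, rfl | rfl⟩ := Int.eq_nat_or_neg k
  · simpa using hx.pow m
  · simpa using hx'.pow m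

/-- A quotient of a Laurent polynomial ring is integral over the base ring if some nonzero power
of each variable is integral, together with its inverse. -/
theorem AddMonoidAlgebra.isIntegral_quotient {R ι : Type*} [CommRing R] [Finite ι] [DecidableEq ι]
    {I : Ideal (AddMonoidAlgebra R (ι → ℤ))}
    (h : ∀ i : ι, ∃ d : ℤ, d ≠ 0 ∧
      IsIntegral R (Ideal.Quotient.mk I (single (Pi.single i d) 1)) ∧
      IsIntegral R (Ideal.Quotient.mk I (single (Pi.single i (-d)) 1))) :
    Algebra.IsIntegral R (AddMonoidAlgebra R (ι → ℤ) ⧸ I) := by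
  cases nonempty_fintype ι
  let u : Multiplicative (ι → ℤ) →* AddMonoidAlgebra R (ι → ℤ) ⧸ I :=
    (Ideal.Quotient.mk I).toMonoidHom.comp (of R (ι → ℤ))
  have hu (i : ι) (k : ℤ) : u (.ofAdd (Pi.single i k)) =
      ↑(u.toHomUnits (.ofAdd (Pi.single i 1)) ^ k) := by
    rw [← map_zpow, ← ofAdd_zsmul, ← Pi.single_smul, smul_eq_mul, mul_one]
    rfl
  have hint (i : ι) (k : ℤ) : IsIntegral R (u (.ofAdd (Pi.single i k))) := by
    obtain ⟨d, hd, h₁, h₂⟩ := h i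
    rw [hu]
    exact Units.isIntegral_zpow hd (hu i d ▸ h₁) (hu i (-d) ▸ h₂) k
  refine ⟨fun x ↦ ?_⟩
  obtain ⟨x, rfl⟩ := Ideal.Quotient.mk_surjective x
  induction x using AddMonoidAlgebra.induction_on with
  | of a =>
    change IsIntegral R (u (.ofAdd a))
    rw [← Finset.univ_sum_single a, ofAdd_sum, map_prod]
    exact IsIntegral.prod _ fun i _ ↦ hint i _
  | add x y hx hy => rw [map_add]; exact hx.add hy
  | smul r x hx => exact hx.smul r

/-- Let `M` be a finitely generated module over `A = ℤ[t₁^{±1},...,t_n^{±1}]`.  Suppose for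
every `i` there are a nonzero integer `d i`, a sequence of integers `r i j → ∞`, and
`A`-module automorphisms `w i j : M → M` with `(w i j)^(r i j)` equal to multiplication by
`t_i^{d i}`.  Then `M` is finitely generated as a `ℤ`-module. -/
theorem stmt2 (n : ℕ) (M : Type) [AddCommGroup M]
    [Module (AddMonoidAlgebra ℤ (Fin n → ℤ)) M]
    [Module.Finite (AddMonoidAlgebra ℤ (Fin n → ℤ)) M]
    (d : Fin n → ℤ) (hd : ∀ i, d i ≠ 0)
    (r : Fin n → ℕ → ℕ) (hr : ∀ i, Tendsto (r i) atTop atTop)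
    (w : Fin n → ℕ → (M ≃ₗ[AddMonoidAlgebra ℤ (Fin n → ℤ)] M))
    (hw : ∀ i j (m : M), (w i j ^ r i j) m =
      (AddMonoidAlgebra.single (Pi.single i (d i) : Fin n → ℤ) (1 : ℤ)) • m) :
    Module.Finite ℤ M := by
  have hend (i : Fin n) (j : ℕ) (k : ℤ) (f : M ≃ₗ[AddMonoidAlgebra ℤ (Fin n → ℤ)] M)
      (hf : ∀ m, (f ^ r i j) m =
        (AddMonoidAlgebra.single (Pi.single i k : Fin n → ℤ) (1 : ℤ)) • m) :
      (f : Module.End (AddMonoidAlgebra ℤ (Fin n → ℤ)) M) ^ r i j =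
        algebraMap _ _ (AddMonoidAlgebra.single (Pi.single i k : Fin n → ℤ) (1 : ℤ)) := by
    ext m
    rw [Module.algebraMap_end_apply, ← hf, Module.End.pow_apply, LinearEquiv.pow_apply]
    rfl
  have hinv (i : Fin n) (j : ℕ) (m : M) : ((w i j)⁻¹ ^ r i j) m =
      (AddMonoidAlgebra.single (Pi.single i (-d i) : Fin n → ℤ) (1 : ℤ)) • m := by
    rw [inv_pow, show (w i j ^ r i j)⁻¹ = (w i j ^ r i j).symm from rfl,
      LinearEquiv.symm_apply_eq, hw, smul_smul,
      AddMonoidAlgebra.single_mul_single, ← Pi.single_add, add_neg_cancel, Pi.single_zero,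
      one_mul, ← AddMonoidAlgebra.one_def, one_smul]
  have hlarge (i : Fin n) (N : ℕ) : ∃ j, N ≤ r i j := ((hr i).eventually_ge_atTop N).exists
  have : Algebra.IsIntegral ℤ (AddMonoidAlgebra ℤ (Fin n → ℤ) ⧸
      Module.annihilator (AddMonoidAlgebra ℤ (Fin n → ℤ)) M) := by
    refine AddMonoidAlgebra.isIntegral_quotient fun i ↦ ⟨d i, hd i, ?_, ?_⟩
    · refine isIntegral_mk_annihilator fun N ↦ ?_
      obtain ⟨j, hj⟩ := hlarge i N
      exact ⟨r i j, hj, _, hend i j _ _ (hw i j)⟩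
    · refine isIntegral_mk_annihilator fun N ↦ ?_
      obtain ⟨j, hj⟩ := hlarge i N
      exact ⟨r i j, hj, _, hend i j _ _ (hinv i j)⟩
  have : Module.Finite ℤ (AddMonoidAlgebra ℤ (Fin n → ℤ) ⧸
      Module.annihilator (AddMonoidAlgebra ℤ (Fin n → ℤ)) M) := Algebra.IsIntegral.finite
  exact .of_finite_quotient_annihilator ℤ (A := AddMonoidAlgebra ℤ (Fin n → ℤ))
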